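/- If D is a domain belonging to 𝒟^PT ∩ 𝒟^DT, then D is Arrow-inconsistent; that is, every SWF F : D → W(X) satisfying unanimity and IIA is dictatorial. -/

import Mathlib

open Set
namespace ArrowSC

/-- A profile assigns to each voter a binary relation (their preference) on alternatives. -/
abbrev Profile (n : ℕ) (X : Type*) := Fin n → X → X → Prop

/-- `r` is a strict total order. -/
def IsSTO {X : Type*} (r : X → X → Prop) : Prop :=
  (∀ x, ¬ r x x) ∧ (∀ x y z, r x y → r y z → r x z) ∧
  (∀ x y, x ≠ y → r x y ∨ r y x)

/-- A genuine profile: every voter's relation is a strict total order, i.e. a member of W(X)^n. -/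
def IsProfile {n : ℕ} {X : Type*} (P : Profile n X) : Prop := ∀ i, IsSTO (P i)

/-- A domain: a nonempty set of profiles, each a member of W(X)^n. -/
def IsDomain {n : ℕ} {X : Type*} (D : Set (Profile n X)) : Prop :=
  D.Nonempty ∧ ∀ P ∈ D, IsProfile P

/-- `F` is a social welfare function on `D`: it sends each profile in `D` to a strict total order. -/
def IsSWF {n : ℕ} {X : Type*} (D : Set (Profile n X))
    (F : Profile n X → X → X → Prop) : Prop :=
  ∀ P ∈ D, IsSTO (F P)

def Unanimity {n : ℕ} {X : Type*} (D : Set (Profile n X))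
    (F : Profile n X → X → X → Prop) : Prop :=
  ∀ P ∈ D, ∀ a b : X, (∀ i, P i a b) → F P a b

def IIA {n : ℕ} {X : Type*} (D : Set (Profile n X))
    (F : Profile n X → X → X → Prop) : Prop :=
  ∀ P ∈ D, ∀ P' ∈ D, ∀ a b : X, (∀ i, P i a b ↔ P' i a b) → (F P a b ↔ F P' a b)

def IsDictator {n : ℕ} {X : Type*} (D : Set (Profile n X))
    (F : Profile n X → X → X → Prop) (d : Fin n) : Prop :=
  ∀ P ∈ D, ∀ a b : X, P d a b → F P a b

def Dictatorial {n : ℕ} {X : Type*} (D : Set (Profile n X))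
    (F : Profile n X → X → X → Prop) : Prop :=
  ∃ d, IsDictator D F d

/-- Coalition `G` is almost-decisive over the ordered pair `(a, b)` w.r.t. `F`. -/
def AlmostDecisivePair {n : ℕ} {X : Type*} (D : Set (Profile n X))
    (F : Profile n X → X → X → Prop) (G : Set (Fin n)) (a b : X) : Prop :=
  ∀ P ∈ D, (∀ i, P i a b ↔ i ∈ G) → F P a b

/-- Coalition `G` is almost-decisive over `Y` w.r.t. `F`. -/
def AlmostDecisiveOn {n : ℕ} {X : Type*} (D : Set (Profile n X))
    (F : Profile n X → X → X → Prop) (G : Set (Fin n)) (Y : Set X) : Prop :=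
  ∀ a ∈ Y, ∀ b ∈ Y, a ≠ b → AlmostDecisivePair D F G a b

/-- Coalition `G` is almost-decisive (over all of X) w.r.t. `F`. -/
def AlmostDecisive {n : ℕ} {X : Type*} (D : Set (Profile n X))
    (F : Profile n X → X → X → Prop) (G : Set (Fin n)) : Prop :=
  ∀ a b : X, a ≠ b → AlmostDecisivePair D F G a b

/-- The restriction of `r` to the triple `{a,b,c}` is the order `a` above `b` above `c`. -/
def RanksTriple {X : Type*} (r : X → X → Prop) (a b c : X) : Prop :=
  r a b ∧ r b c ∧ r a c

/-- The polarized profile `(G : abc, Gᶜ : a'b'c')` on a triple is a subprofile of `D`,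
i.e. it belongs to the restriction `D|_{triple}`. -/
def HasPolarizedSubprofile {n : ℕ} {X : Type*} (D : Set (Profile n X)) (G : Set (Fin n))
    (a b c a' b' c' : X) : Prop :=
  ∃ P ∈ D, ∀ i, (i ∈ G → RanksTriple (P i) a b c) ∧ (i ∉ G → RanksTriple (P i) a' b' c')

/-- `D_1(G, {a,b,c}) ⊆ D|_{{a,b,c}}`. -/
def D1sub {n : ℕ} {X : Type*} (D : Set (Profile n X)) (G : Set (Fin n)) (a b c : X) : Prop :=
  HasPolarizedSubprofile D G b c a a b c ∧
  HasPolarizedSubprofile D G b a c a c b ∧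
  HasPolarizedSubprofile D G a b c c a b ∧
  HasPolarizedSubprofile D G a c b c b a ∧
  HasPolarizedSubprofile D G c a b b c a ∧
  HasPolarizedSubprofile D G c b a b a c

/-- `D_2(G, {a,b,c}) ⊆ D|_{{a,b,c}}`. -/
def D2sub {n : ℕ} {X : Type*} (D : Set (Profile n X)) (G : Set (Fin n)) (a b c : X) : Prop :=
  HasPolarizedSubprofile D G a b c b c a ∧
  HasPolarizedSubprofile D G a c b b a c ∧
  HasPolarizedSubprofile D G c a b a b c ∧
  HasPolarizedSubprofile D G c b a a c b ∧
  HasPolarizedSubprofile D G b c a c a b ∧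
  HasPolarizedSubprofile D G b a c c b a

/-- The class 𝒟^PT of polarization over triples. -/
def ClassPT {n : ℕ} {X : Type*} (D : Set (Profile n X)) : Prop :=
  ∀ G : Set (Fin n), G ≠ ∅ → G ≠ univ →
    ∀ a b c : X, a ≠ b → b ≠ c → a ≠ c →
      D1sub D G a b c ∨ D2sub D G a b c

/-- The class 𝒟^DT of diversity over triples. -/
def ClassDT {n : ℕ} {X : Type*} (D : Set (Profile n X)) : Prop :=
  ∀ G G' : Set (Fin n), ¬ G ⊆ G' → ¬ G' ⊆ G →
    ∃ a b c : X, a ≠ b ∧ b ≠ c ∧ a ≠ c ∧ ∃ P ∈ D, ∀ i,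
      (P i a b ↔ i ∈ G) ∧ (P i b c ↔ i ∈ G') ∧ (P i c a ↔ i ∉ G ∩ G')

/-- `D` is Arrow-inconsistent. -/
def ArrowInconsistent {n : ℕ} {X : Type*} (D : Set (Profile n X)) : Prop :=
  ∀ F : Profile n X → X → X → Prop,
    IsSWF D F → Unanimity D F → IIA D F → Dictatorial D F

/-- `a` is the most-preferred among `{a,b,c}` according to `r`. -/
def TripleBest {X : Type*} (r : X → X → Prop) (a b c : X) : Prop := r a b ∧ r a c

/-- `a` is the least-preferred among `{a,b,c}` according to `r`. -/
def TripleWorst {X : Type*} (r : X → X → Prop) (a b c : X) : Prop := r b a ∧ r c a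

/-- `a` is the middle-preferred among `{a,b,c}` according to `r`. -/
def TripleMiddle {X : Type*} (r : X → X → Prop) (a b c : X) : Prop :=
  (r b a ∧ r a c) ∨ (r c a ∧ r a b)

/-- In profile `P`, alternative `a` is never placed as the most-preferred, or never as the
middle-preferred, or never as the least-preferred alternative among `{a,b,c}`. -/
def NeverBMW {n : ℕ} {X : Type*} (P : Profile n X) (a b c : X) : Prop :=
  (∀ i, ¬ TripleBest (P i) a b c) ∨ (∀ i, ¬ TripleMiddle (P i) a b c) ∨
  (∀ i, ¬ TripleWorst (P i) a b c)

/-- Sen's value-restriction of a profile over `Y`. -/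
def ValueRestricted {n : ℕ} {X : Type*} (P : Profile n X) (Y : Set X) : Prop :=
  ∀ a ∈ Y, ∀ b ∈ Y, ∀ c ∈ Y, a ≠ b → b ≠ c → a ≠ c →
    NeverBMW P a b c ∨ NeverBMW P b a c ∨ NeverBMW P c a b

/-- The strict total order on the triple `{a,b,c}` ranking `a` above `b` above `c`,
viewed as a relation with support in `{a,b,c}`. -/
def seqOrder {X : Type*} (a b c : X) : X → X → Prop :=
  fun x y => (x = a ∧ y = b) ∨ (x = b ∧ y = c) ∨ (x = a ∧ y = c)

/-- `r` is a strict total order on the triple `{a,b,c}` (with support in the triple). -/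
def IsTripleOrder {X : Type*} (a b c : X) (r : X → X → Prop) : Prop :=
  (∀ x y, r x y → x ∈ ({a, b, c} : Set X) ∧ y ∈ ({a, b, c} : Set X)) ∧
  (∀ x, ¬ r x x) ∧ (∀ x y z, r x y → r y z → r x z) ∧
  (∀ x ∈ ({a, b, c} : Set X), ∀ y ∈ ({a, b, c} : Set X), x ≠ y → r x y ∨ r y x)

/-- The polarized profile `(G : Q, Gᶜ : Q')`. -/
def polarizedProfile {n : ℕ} {X : Type*} (G : Set (Fin n)) (Q Q' : X → X → Prop) :
    Profile n X :=
  fun i x y => (i ∈ G ∧ Q x y) ∨ (i ∉ G ∧ Q' x y)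

/-- `Q` and `Q'` differ on how they rank the pair `{x, y}`. -/
def DifferOn {X : Type*} (Q Q' : X → X → Prop) (x y : X) : Prop := ¬ (Q x y ↔ Q' x y)

/-- `Q` and `Q'` differ on exactly two of the three unordered pairs of the triple `{a,b,c}`
and coincide on the remaining pair. -/
def StronglyPolarizedPair {X : Type*} (a b c : X) (Q Q' : X → X → Prop) : Prop :=
  (DifferOn Q Q' a b ∧ DifferOn Q Q' b c ∧ ¬ DifferOn Q Q' a c) ∨
  (DifferOn Q Q' a b ∧ ¬ DifferOn Q Q' b c ∧ DifferOn Q Q' a c) ∨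
  (¬ DifferOn Q Q' a b ∧ DifferOn Q Q' b c ∧ DifferOn Q Q' a c)

/-- The set `D_1(G, {a,b,c})` of polarized profiles on the triple `{a,b,c}`. -/
def D1set {n : ℕ} {X : Type*} (G : Set (Fin n)) (a b c : X) : Set (Profile n X) :=
  { polarizedProfile G (seqOrder b c a) (seqOrder a b c),
    polarizedProfile G (seqOrder b a c) (seqOrder a c b),
    polarizedProfile G (seqOrder a b c) (seqOrder c a b),
    polarizedProfile G (seqOrder a c b) (seqOrder c b a),
    polarizedProfile G (seqOrder c a b) (seqOrder b c a),
    polarizedProfile G (seqOrder c b a) (seqOrder b a c) }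

/-- The set `D_2(G, {a,b,c})` of polarized profiles on the triple `{a,b,c}`. -/
def D2set {n : ℕ} {X : Type*} (G : Set (Fin n)) (a b c : X) : Set (Profile n X) :=
  { polarizedProfile G (seqOrder a b c) (seqOrder b c a),
    polarizedProfile G (seqOrder a c b) (seqOrder b a c),
    polarizedProfile G (seqOrder c a b) (seqOrder a b c),
    polarizedProfile G (seqOrder c b a) (seqOrder a c b),
    polarizedProfile G (seqOrder b c a) (seqOrder c a b),
    polarizedProfile G (seqOrder b a c) (seqOrder c b a) }

/-- The set of all strongly polarized profiles on the triple `{a,b,c}`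
of the form `(G : Q, Gᶜ : Q')`. -/
def SPset {n : ℕ} {X : Type*} (G : Set (Fin n)) (a b c : X) : Set (Profile n X) :=
  { p | ∃ Q Q', IsTripleOrder a b c Q ∧ IsTripleOrder a b c Q' ∧
      StronglyPolarizedPair a b c Q Q' ∧ p = polarizedProfile G Q Q' }
section

variable {X : Type*} {n : ℕ} {D : Set (Profile n X)} {F : Profile n X → X → X → Prop}
  {G G' : Set (Fin n)} {a b c : X}

theorem IsSTO.asymm {r : X → X → Prop} (h : IsSTO r) (hab : r a b) : ¬ r b a :=
  fun hba => h.1 a (h.2.1 a b a hab hba)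

theorem IIA.almostDecisivePair {P : Profile n X} (hI : IIA D F) (hP : P ∈ D)
    (hab : ∀ i, P i a b ↔ i ∈ G) (hF : F P a b) : AlmostDecisivePair D F G a b :=
  fun Q hQ h => (hI P hP Q hQ a b fun i => (hab i).trans (h i).symm).1 hF

/-- If `G` ranks `abc` and the others rank `bca`, almost-decisiveness passes from `(a, b)` to
`(a, c)`. -/
theorem HasPolarizedSubprofile.almostDecisivePair_right
    (hP : HasPolarizedSubprofile D G a b c b c a) (hD : IsDomain D) (hF : IsSWF D F)
    (hU : Unanimity D F) (hI : IIA D F) (h : AlmostDecisivePair D F G a b) :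
    AlmostDecisivePair D F G a c := by
  obtain ⟨P, hPD, hP⟩ := hP
  have key (i) : (P i a b ↔ i ∈ G) ∧ P i b c ∧ (P i a c ↔ i ∈ G) := by
    by_cases hi : i ∈ G
    · obtain ⟨h1, h2, h3⟩ := (hP i).1 hi
      simp [*]
    · obtain ⟨h1, h2, h3⟩ := (hP i).2 hi
      simp [hi, h1, (hD.2 P hPD i).asymm h2, (hD.2 P hPD i).asymm h3]
  exact hI.almostDecisivePair hPD (fun i => (key i).2.2)
    ((hF P hPD).2.1 a b c (h P hPD fun i => (key i).1) (hU P hPD b c fun i => (key i).2.1))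

/-- If `G` ranks `abc` and the others rank `cab`, almost-decisiveness passes from `(b, c)` to
`(a, c)`. -/
theorem HasPolarizedSubprofile.almostDecisivePair_left
    (hP : HasPolarizedSubprofile D G a b c c a b) (hD : IsDomain D) (hF : IsSWF D F)
    (hU : Unanimity D F) (hI : IIA D F) (h : AlmostDecisivePair D F G b c) :
    AlmostDecisivePair D F G a c := by
  obtain ⟨P, hPD, hP⟩ := hP
  have key (i) : (P i b c ↔ i ∈ G) ∧ P i a b ∧ (P i a c ↔ i ∈ G) := by
    by_cases hi : i ∈ G
    · obtain ⟨h1, h2, h3⟩ := (hP i).1 hi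
      simp [*]
    · obtain ⟨h1, h2, h3⟩ := (hP i).2 hi
      simp [hi, h2, (hD.2 P hPD i).asymm h1, (hD.2 P hPD i).asymm h3]
  exact hI.almostDecisivePair hPD (fun i => (key i).2.2)
    ((hF P hPD).2.1 a b c (hU P hPD a b fun i => (key i).2.1) (h P hPD fun i => (key i).1))

/-- Over a polarized triple, almost-decisiveness on one pair spreads around the triple. -/
theorem AlmostDecisivePair.triple (h : AlmostDecisivePair D F G a b) (hD : IsDomain D)
    (hPT : ClassPT D) (hF : IsSWF D F) (hU : Unanimity D F) (hI : IIA D F) (h0 : G ≠ ∅)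
    (h1 : G ≠ univ) (hab : a ≠ b) (hbc : b ≠ c) (hac : a ≠ c) :
    AlmostDecisivePair D F G a c ∧ AlmostDecisivePair D F G c b := by
  rcases hPT G h0 h1 a b c hab hbc hac with ⟨p1, p2, p3, p4, p5, p6⟩ | ⟨p1, p2, p3, p4, p5, p6⟩
  · have cb := p5.almostDecisivePair_left hD hF hU hI h
    have ca := p6.almostDecisivePair_right hD hF hU hI cb
    have ba := p1.almostDecisivePair_left hD hF hU hI ca
    have bc := p2.almostDecisivePair_right hD hF hU hI ba
    exact ⟨p3.almostDecisivePair_left hD hF hU hI bc, cb⟩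
  · have ac := p1.almostDecisivePair_right hD hF hU hI h
    have bc := p6.almostDecisivePair_left hD hF hU hI ac
    have ba := p5.almostDecisivePair_right hD hF hU hI bc
    have ca := p4.almostDecisivePair_left hD hF hU hI ba
    exact ⟨ac, p3.almostDecisivePair_right hD hF hU hI ca⟩

theorem exists_ne_ne [Fintype X] (hX : 3 ≤ Fintype.card X) (a b : X) : ∃ c, a ≠ c ∧ b ≠ c := by
  classical
  obtain ⟨c, -, hc⟩ := Finset.exists_mem_notMem_of_card_lt_card
    (s := {a, b}) (t := Finset.univ) (Finset.card_le_two.trans_lt hX)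
  simp only [Finset.mem_insert, Finset.mem_singleton, not_or] at hc
  exact ⟨c, Ne.symm hc.1, Ne.symm hc.2⟩

theorem AlmostDecisivePair.almostDecisive [Fintype X] (hX : 3 ≤ Fintype.card X)
    (h : AlmostDecisivePair D F G a b) (hD : IsDomain D) (hPT : ClassPT D) (hF : IsSWF D F)
    (hU : Unanimity D F) (hI : IIA D F) (h0 : G ≠ ∅) (h1 : G ≠ univ) (hab : a ≠ b) :
    AlmostDecisive D F G := by
  have right {x y z : X} (h : AlmostDecisivePair D F G x y) (hxy : x ≠ y) (hxz : x ≠ z) :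
      AlmostDecisivePair D F G x z := by
    obtain rfl | hyz := eq_or_ne y z
    · exact h
    · exact (h.triple hD hPT hF hU hI h0 h1 hxy hyz hxz).1
  have left {x y z : X} (h : AlmostDecisivePair D F G x y) (hxy : x ≠ y) (hzy : z ≠ y) :
      AlmostDecisivePair D F G z y := by
    obtain rfl | hxz := eq_or_ne x z
    · exact h
    · exact (h.triple hD hPT hF hU hI h0 h1 hxy hzy.symm hxz).2
  intro x y hxy
  obtain rfl | hay := eq_or_ne a y
  · obtain ⟨c, hac, hxc⟩ := exists_ne_ne hX a x
    exact right (left (right h hab hac) hac hxc) hxc hxy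
  · exact left (right h hab hay) hay hxy

theorem ClassPT.exists_pair [Fintype X] (hX : 3 ≤ Fintype.card X) (hPT : ClassPT D)
    (hD : IsDomain D) (h0 : G ≠ ∅) (h1 : G ≠ univ) (hab : a ≠ b) :
    ∃ P ∈ D, ∀ i, P i a b ↔ i ∈ G := by
  obtain ⟨c, hac, hbc⟩ := exists_ne_ne hX a b
  have key : HasPolarizedSubprofile D G a c b c b a ∨ HasPolarizedSubprofile D G a c b b a c :=
    (hPT G h0 h1 a b c hab hbc hac).imp (fun h => h.2.2.2.1) (fun h => h.2.1)
  rcases key with ⟨P, hPD, hP⟩ | ⟨P, hPD, hP⟩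
  · refine ⟨P, hPD, fun i => ⟨fun h => ?_, fun hi => ((hP i).1 hi).2.2⟩⟩
    by_contra hi
    exact (hD.2 P hPD i).asymm h ((hP i).2 hi).2.1
  · refine ⟨P, hPD, fun i => ⟨fun h => ?_, fun hi => ((hP i).1 hi).2.2⟩⟩
    by_contra hi
    exact (hD.2 P hPD i).asymm h ((hP i).2 hi).1

theorem AlmostDecisive.of_univ (hU : Unanimity D F) : AlmostDecisive D F univ :=
  fun a b _ P hP h => hU P hP a b fun i => (h i).2 (mem_univ i)

theorem AlmostDecisive.inter [Fintype X] (hX : 3 ≤ Fintype.card X)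
    (hG : AlmostDecisive D F G) (hG' : AlmostDecisive D F G') (hne : G.Nonempty)
    (hne' : G'.Nonempty) (hD : IsDomain D) (hPT : ClassPT D) (hDT : ClassDT D) (hF : IsSWF D F)
    (hU : Unanimity D F) (hI : IIA D F) :
    (G ∩ G').Nonempty ∧ AlmostDecisive D F (G ∩ G') := by
  by_cases h1 : G ⊆ G'
  · rw [inter_eq_left.2 h1]
    exact ⟨hne, hG⟩
  by_cases h2 : G' ⊆ G
  · rw [inter_eq_right.2 h2]
    exact ⟨hne', hG'⟩
  obtain ⟨a, b, c, hab, hbc, hac, P, hPD, hP⟩ := hDT G G' h1 h2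
  have Fac : F P a c := (hF P hPD).2.1 a b c (hG a b hab P hPD fun i => (hP i).1)
    (hG' b c hbc P hPD fun i => (hP i).2.1)
  have hne : G ∩ G' ≠ ∅ := fun h => (hF P hPD).asymm Fac
    (hU P hPD c a fun i => (hP i).2.2.2 (h ▸ notMem_empty i))
  have hPac (i) : P i a c ↔ i ∈ G ∩ G' := by
    have hi := hD.2 P hPD i
    constructor
    · intro h
      by_contra hn
      exact hi.asymm h ((hP i).2.2.2 hn)
    · intro h
      exact (hi.2.2 a c hac).resolve_right fun hca => (hP i).2.2.1 hca h
  exact ⟨nonempty_iff_ne_empty.2 hne,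
    (hI.almostDecisivePair hPD hPac Fac).almostDecisive hX hD hPT hF hU hI hne
      (fun h => h1 (fun i _ => (h.symm.subset (mem_univ i)).2)) hac⟩

theorem almostDecisive_or_compl [Fintype X] (hX : 3 ≤ Fintype.card X) (hD : IsDomain D)
    (hPT : ClassPT D) (hF : IsSWF D F) (hU : Unanimity D F) (hI : IIA D F) (h0 : G ≠ ∅)
    (h1 : G ≠ univ) : AlmostDecisive D F G ∨ AlmostDecisive D F Gᶜ := by
  obtain ⟨a, b, hab⟩ := Fintype.exists_pair_of_one_lt_card (show 1 < Fintype.card X by omega)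
  obtain ⟨P, hPD, hP⟩ := hPT.exists_pair hX hD h0 h1 hab
  have hPba (i) : P i b a ↔ i ∈ Gᶜ := by
    have hi := hD.2 P hPD i
    rw [mem_compl_iff, ← hP i]
    exact ⟨hi.asymm, (hi.2.2 a b hab).resolve_left⟩
  rcases (hF P hPD).2.2 a b hab with h | h
  · exact .inl ((hI.almostDecisivePair hPD hP h).almostDecisive hX hD hPT hF hU hI h0 h1 hab)
  · exact .inr ((hI.almostDecisivePair hPD hPba h).almostDecisive hX hD hPT hF hU hI
      (by simpa using h1) (by simpa using h0) hab.symm)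

end

/-- the generalization of Arrow's theorem: every domain in
𝒟^PT ∩ 𝒟^DT is Arrow-inconsistent. -/
theorem arrow_generalization {X : Type*} [Fintype X] {n : ℕ}
    (hX : 3 ≤ Fintype.card X) (hn : 2 ≤ n)
    (D : Set (Profile n X)) (hD : IsDomain D)
    (hPT : ClassPT D) (hDT : ClassDT D) :
    ArrowInconsistent D := by
  intro F hF hU hI
  have : NeZero n := ⟨by omega⟩
  let U : Set (Set (Fin n)) := {G | G.Nonempty ∧ AlmostDecisive D F G}
  have inter_mem {G G'} (h : G ∈ U) (h' : G' ∈ U) : G ∩ G' ∈ U :=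
    h.2.inter hX h'.2 h.1 h'.1 hD hPT hDT hF hU hI
  have univ_mem : univ ∈ U := ⟨univ_nonempty, .of_univ hU⟩
  have mem_or {G} : G ∈ U ∨ Gᶜ ∈ U := by
    by_cases h0 : G = ∅
    · exact .inr (by simpa [h0] using univ_mem)
    by_cases h1 : G = univ
    · exact .inl (h1 ▸ univ_mem)
    exact (almostDecisive_or_compl hX hD hPT hF hU hI h0 h1).imp
      (fun h => ⟨nonempty_iff_ne_empty.2 h0, h⟩) (fun h => ⟨nonempty_compl.2 h1, h⟩)
  have disjoint_mem {G G'} (h : G ∈ U) (h' : G' ∈ U) : ¬ Disjoint G G' :=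
    not_disjoint_iff_nonempty_inter.2 (inter_mem h h').1
  let f : Filter (Fin n) :=
    { sets := U
      univ_sets := univ_mem
      sets_of_superset := fun h hs => mem_or.resolve_right fun hc =>
        disjoint_mem h hc (disjoint_compl_right_iff_subset.2 hs)
      inter_sets := inter_mem }
  obtain ⟨d, hd⟩ := (Ultrafilter.ofComplNotMemIff f fun _ =>
    ⟨mem_or.resolve_right, fun h hc => disjoint_mem h hc disjoint_compl_right⟩).eq_pure_of_finite
  have mem_iff (G : Set (Fin n)) : G ∈ U ↔ d ∈ G :=
    (Iff.of_eq (congrArg (G ∈ ·) hd)).trans Ultrafilter.mem_pure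
  refine ⟨d, fun P hP a b hab => ?_⟩
  have hne : a ≠ b := by
    rintro rfl
    exact (hD.2 P hP d).1 a hab
  exact ((mem_iff {i | P i a b}).2 hab).2 a b hne P hP fun _ => Iff.rfl

end ArrowSC
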